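/- arXiv:math/9204239 — 2 statements merged into one kernel-verified Lean document; each statement's English description precedes it below -/
import Mathlib

section
/- For every smooth compactly supported function u : ℝ³ → ℝ, sup |u| ≤ (2π)^(-1/2) · (∫ |∇u|² dx)^(1/4) · (∫ |Δu|² dx)^(1/4). -/
open MeasureTheory Filter

noncomputable section

abbrev E3 := EuclideanSpace ℝ (Fin 3)

/-- The (classical) Laplacian of a function on `ℝ³`. -/
def lap (u : E3 → ℝ) (x : E3) : ℝ :=
  ∑ i : Fin 3, fderiv ℝ (fun y => fderiv ℝ u y (EuclideanSpace.single i 1)) x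
    (EuclideanSpace.single i 1)

open scoped FourierTransform LineDeriv SchwartzMap

section Schwartz

variable {V : Type*} [NormedAddCommGroup V] [InnerProductSpace ℝ V] [FiniteDimensional ℝ V]
  [MeasurableSpace V] [BorelSpace V] {ι : Type*} [Fintype ι]

lemma SchwartzMap.integrable_norm_sq (f : 𝓢(V, ℂ)) : Integrable (fun x => ‖f x‖ ^ 2) :=
  (f.memLp 2).integrable_norm_pow two_ne_zero

lemma SchwartzMap.fourier_lineDerivOp_apply (f : 𝓢(V, ℂ)) (m ξ : V) :
    𝓕 (∂_{m} f) ξ = 2 * Real.pi * Complex.I * ((inner ℝ ξ m : ℝ) * 𝓕 f ξ) := by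
  have hm : (inner ℝ · m : V → ℝ).HasTemperateGrowth := by fun_prop
  rw [SchwartzMap.fourier_lineDerivOp_eq, smul_apply,
    SchwartzMap.smulLeftCLM_apply_apply hm, Complex.real_smul, smul_eq_mul]

lemma SchwartzMap.sum_norm_sq_fourier_lineDerivOp (f : 𝓢(V, ℂ)) (b : OrthonormalBasis ι ℝ V)
    (ξ : V) :
    ∑ i, ‖𝓕 (∂_{b i} f) ξ‖ ^ 2 = (2 * Real.pi * ‖ξ‖) ^ 2 * ‖𝓕 f ξ‖ ^ 2 := by
  rw [mul_pow _ ‖ξ‖, ← b.sum_sq_norm_inner_left ξ, Finset.mul_sum, Finset.sum_mul]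
  refine Finset.sum_congr rfl fun i _ => ?_
  simp only [f.fourier_lineDerivOp_apply, norm_mul, Complex.norm_real, Complex.norm_I,
    Complex.norm_ofNat, Real.norm_eq_abs, abs_of_pos Real.pi_pos]
  ring

lemma SchwartzMap.norm_fourier_sum_lineDerivOp_sq (f : 𝓢(V, ℂ)) (b : OrthonormalBasis ι ℝ V)
    (ξ : V) :
    ‖𝓕 (∑ i, ∂_{b i} (∂_{b i} f)) ξ‖ ^ 2 = (2 * Real.pi * ‖ξ‖) ^ 4 * ‖𝓕 f ξ‖ ^ 2 := by
  have h : 𝓕 (∑ i, ∂_{b i} (∂_{b i} f)) ξ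
      = -((2 * Real.pi * ‖ξ‖ : ℝ) : ℂ) ^ 2 * 𝓕 f ξ := by
    have hs : 𝓕 (∑ i, ∂_{b i} (∂_{b i} f)) = ∑ i, 𝓕 (∂_{b i} (∂_{b i} f)) :=
      map_sum (FourierTransform.fourierCLM ℂ 𝓢(V, ℂ)) _ _
    have hn : (‖ξ‖ : ℂ) ^ 2 = ∑ i, ((inner ℝ ξ (b i) : ℝ) : ℂ) ^ 2 := by
      rw [← Complex.ofReal_pow, ← b.sum_sq_norm_inner_left ξ]
      simp
    rw [hs, sum_apply]
    push_cast
    rw [mul_pow _ (‖ξ‖ : ℂ), hn, Finset.mul_sum, ← Finset.sum_neg_distrib, Finset.sum_mul]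
    refine Finset.sum_congr rfl fun i _ => ?_
    simp only [SchwartzMap.fourier_lineDerivOp_apply]
    linear_combination (4 * Real.pi ^ 2 * (inner ℝ ξ (b i) : ℝ) ^ 2 * 𝓕 f ξ) * Complex.I_sq
  rw [h, norm_mul, norm_neg, norm_pow, Complex.norm_real, Real.norm_eq_abs, sq_abs]
  ring

lemma SchwartzMap.integrable_norm_sq_fourier_sq (f : 𝓢(V, ℂ)) :
    Integrable (fun ξ => (2 * Real.pi * ‖ξ‖) ^ 2 * ‖𝓕 f ξ‖ ^ 2) := by
  simp_rw [← f.sum_norm_sq_fourier_lineDerivOp (stdOrthonormalBasis ℝ V)]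
  exact integrable_finsetSum _ fun i _ => SchwartzMap.integrable_norm_sq _

lemma SchwartzMap.integral_norm_sq_fourier_sq (f : 𝓢(V, ℂ)) (b : OrthonormalBasis ι ℝ V) :
    ∫ ξ, (2 * Real.pi * ‖ξ‖) ^ 2 * ‖𝓕 f ξ‖ ^ 2 = ∫ x, ∑ i, ‖(∂_{b i} f) x‖ ^ 2 := by
  simp_rw [← f.sum_norm_sq_fourier_lineDerivOp b]
  rw [integral_finsetSum _ fun i _ => SchwartzMap.integrable_norm_sq _,
    integral_finsetSum _ fun i _ => SchwartzMap.integrable_norm_sq _]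
  exact Finset.sum_congr rfl fun i _ => SchwartzMap.integral_norm_sq_fourier _

lemma SchwartzMap.integrable_norm_pow_four_fourier_sq (f : 𝓢(V, ℂ)) :
    Integrable (fun ξ => (2 * Real.pi * ‖ξ‖) ^ 4 * ‖𝓕 f ξ‖ ^ 2) := by
  simp_rw [← f.norm_fourier_sum_lineDerivOp_sq (stdOrthonormalBasis ℝ V)]
  exact SchwartzMap.integrable_norm_sq _

lemma SchwartzMap.integral_norm_pow_four_fourier_sq (f : 𝓢(V, ℂ)) (b : OrthonormalBasis ι ℝ V) :
    ∫ ξ, (2 * Real.pi * ‖ξ‖) ^ 4 * ‖𝓕 f ξ‖ ^ 2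
      = ∫ x, ‖(∑ i, ∂_{b i} (∂_{b i} f)) x‖ ^ 2 := by
  simp_rw [← f.norm_fourier_sum_lineDerivOp_sq b]
  exact SchwartzMap.integral_norm_sq_fourier _

lemma SchwartzMap.norm_le_integral_norm_fourier (f : 𝓢(V, ℂ)) (x : V) :
    ‖f x‖ ≤ ∫ ξ, ‖𝓕 f ξ‖ := by
  have h : f x = 𝓕⁻ (⇑(𝓕 f : 𝓢(V, ℂ))) x := by
    rw [← SchwartzMap.fourierInv_coe, FourierTransform.fourierInv_fourier_eq]
  rw [h, Real.fourierInv_eq]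
  refine (norm_integral_le_integral_norm _).trans_eq ?_
  simp

end Schwartz

section Weight

lemma integral_Ioi_inv_sq_add_sq {p q : ℝ} (hp : 0 < p) (hq : 0 < q) :
    IntegrableOn (fun r : ℝ => (p ^ 2 + (q * r) ^ 2)⁻¹) (Set.Ioi 0) ∧
      ∫ r in Set.Ioi (0 : ℝ), (p ^ 2 + (q * r) ^ 2)⁻¹ = Real.pi / (2 * p * q) := by
  have h : (fun r : ℝ => (p ^ 2 + (q * r) ^ 2)⁻¹)
      = fun r => (p ^ 2)⁻¹ * (1 + (q / p * r) ^ 2)⁻¹ := by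
    ext r
    rw [← mul_inv]
    congr 1
    field_simp
  have hc : 0 < q / p := by positivity
  rw [h]
  constructor
  · refine Integrable.const_mul ?_ _
    refine (integrableOn_Ioi_comp_mul_left_iff (fun r : ℝ => (1 + r ^ 2)⁻¹) 0 hc).2 ?_
    exact integrable_inv_one_add_sq.integrableOn
  · rw [integral_const_mul, integral_comp_mul_left_Ioi (fun r : ℝ => (1 + r ^ 2)⁻¹) 0 hc,
      integral_Ioi_inv_one_add_sq]
    simp
    field_simp

/-- The multiplier of `-α² Δ + β² Δ²` as a function of the norm of the frequency. -/
def biharmonicSymbol (α β r : ℝ) : ℝ :=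
  α ^ 2 * (2 * Real.pi * r) ^ 2 + β ^ 2 * (2 * Real.pi * r) ^ 4

lemma biharmonicSymbol_pos {α β r : ℝ} (hα : 0 < α) (hβ : 0 < β) (hr : 0 < r) :
    0 < biharmonicSymbol α β r := by
  have := Real.pi_pos
  unfold biharmonicSymbol
  positivity

lemma sq_mul_inv_biharmonicSymbol (α β : ℝ) {r : ℝ} (hr : 0 < r) :
    r ^ 2 * (biharmonicSymbol α β r)⁻¹
      = ((2 * Real.pi * α) ^ 2 + (4 * Real.pi ^ 2 * β * r) ^ 2)⁻¹ := by
  have h : biharmonicSymbol α β r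
      = r ^ 2 * ((2 * Real.pi * α) ^ 2 + (4 * Real.pi ^ 2 * β * r) ^ 2) := by
    unfold biharmonicSymbol
    ring
  rw [h, mul_inv, mul_inv_cancel_left₀ (by positivity)]

lemma integrable_inv_biharmonicSymbol {α β : ℝ} (hα : 0 < α) (hβ : 0 < β) :
    Integrable (fun ξ : E3 => (biharmonicSymbol α β ‖ξ‖)⁻¹) := by
  have := Real.pi_pos
  rw [integrable_fun_norm_addHaar volume (f := fun r => (biharmonicSymbol α β r)⁻¹)]
  refine (integrableOn_congr_fun (fun r hr => ?_) measurableSet_Ioi).2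
    (integral_Ioi_inv_sq_add_sq (p := 2 * Real.pi * α) (q := 4 * Real.pi ^ 2 * β)
      (by positivity) (by positivity)).1
  simpa using sq_mul_inv_biharmonicSymbol α β hr

lemma integral_inv_biharmonicSymbol {α β : ℝ} (hα : 0 < α) (hβ : 0 < β) :
    ∫ ξ : E3, (biharmonicSymbol α β ‖ξ‖)⁻¹ = (4 * Real.pi * α * β)⁻¹ := by
  have hπ := Real.pi_pos
  have hball : (volume : Measure E3).real (Metric.ball 0 1) = 4 / 3 * Real.pi := by
    rw [Measure.real, InnerProductSpace.volume_ball_of_dim_odd (k := 1) (by simp)]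
    simp [Nat.doubleFactorial]
    rw [ENNReal.toReal_ofReal (by positivity)]
    ring
  rw [integral_fun_norm_addHaar volume (fun r => (biharmonicSymbol α β r)⁻¹), hball,
    setIntegral_congr_fun (g := fun r => ((2 * Real.pi * α) ^ 2 + (4 * Real.pi ^ 2 * β * r) ^ 2)⁻¹)
      measurableSet_Ioi
      (fun r hr => by simpa using sq_mul_inv_biharmonicSymbol α β hr),
    (integral_Ioi_inv_sq_add_sq (by positivity) (by positivity)).2]
  simp
  field_simp
  norm_num

end Weight

lemma SchwartzMap.integral_norm_fourier_le (f : 𝓢(E3, ℂ)) {p q : ℝ} (hp : 0 < p) (hq : 0 < q)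
    (hA : ∫ ξ, (2 * Real.pi * ‖ξ‖) ^ 2 * ‖𝓕 f ξ‖ ^ 2 ≤ p ^ 4)
    (hB : ∫ ξ, (2 * Real.pi * ‖ξ‖) ^ 4 * ‖𝓕 f ξ‖ ^ 2 ≤ q ^ 4) :
    ∫ ξ, ‖𝓕 f ξ‖ ≤ (Real.sqrt (2 * Real.pi))⁻¹ * (p * q) := by
  have hπ := Real.pi_pos
  set s := Real.sqrt (2 * Real.pi) with hs
  have hs0 : 0 < s := by positivity
  have hs2 : s ^ 2 = 2 * Real.pi := Real.sq_sqrt (by positivity)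
  set t := (2 * p * q * s)⁻¹ with ht
  have ht0 : 0 < t := by positivity
  have hα : 0 < q / p := by positivity
  have hβ : 0 < p / q := by positivity
  have hiA := f.integrable_norm_sq_fourier_sq.const_mul (t / 2 * (q / p) ^ 2)
  have hiB := f.integrable_norm_pow_four_fourier_sq.const_mul (t / 2 * (p / q) ^ 2)
  have hiw := (integrable_inv_biharmonicSymbol hα hβ).const_mul (1 / (2 * t))
  have hae : ∀ᵐ ξ : E3, ‖𝓕 f ξ‖ ≤
      t / 2 * (q / p) ^ 2 * ((2 * Real.pi * ‖ξ‖) ^ 2 * ‖𝓕 f ξ‖ ^ 2)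
        + t / 2 * (p / q) ^ 2 * ((2 * Real.pi * ‖ξ‖) ^ 4 * ‖𝓕 f ξ‖ ^ 2)
        + 1 / (2 * t) * (biharmonicSymbol (q / p) (p / q) ‖ξ‖)⁻¹ := by
    filter_upwards [Measure.ae_ne volume (0 : E3)] with ξ hξ
    have hw := biharmonicSymbol_pos hα hβ (norm_pos_iff.2 hξ)
    set w := biharmonicSymbol (q / p) (p / q) ‖ξ‖ with hwdef
    have key : t / 2 * w * ‖𝓕 f ξ‖ ^ 2 + 1 / (2 * t) * w⁻¹ - ‖𝓕 f ξ‖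
        = (t * w * ‖𝓕 f ξ‖ - 1) ^ 2 / (2 * t * w) := by
      field_simp
      ring
    have h0 : 0 ≤ (t * w * ‖𝓕 f ξ‖ - 1) ^ 2 / (2 * t * w) := by positivity
    have hexp : t / 2 * w * ‖𝓕 f ξ‖ ^ 2
        = t / 2 * (q / p) ^ 2 * ((2 * Real.pi * ‖ξ‖) ^ 2 * ‖𝓕 f ξ‖ ^ 2)
          + t / 2 * (p / q) ^ 2 * ((2 * Real.pi * ‖ξ‖) ^ 4 * ‖𝓕 f ξ‖ ^ 2) := by
      rw [hwdef, biharmonicSymbol]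
      ring
    linarith
  calc ∫ ξ, ‖𝓕 f ξ‖
      ≤ t / 2 * (q / p) ^ 2 * (∫ ξ, (2 * Real.pi * ‖ξ‖) ^ 2 * ‖𝓕 f ξ‖ ^ 2)
        + t / 2 * (p / q) ^ 2 * (∫ ξ, (2 * Real.pi * ‖ξ‖) ^ 4 * ‖𝓕 f ξ‖ ^ 2)
        + 1 / (2 * t) * (4 * Real.pi * (q / p) * (p / q))⁻¹ := by
        refine (integral_mono_ae (𝓕 f).integrable.norm ((hiA.add hiB).add hiw) hae).trans_eq ?_
        rw [integral_add' (hiA.add hiB) hiw, integral_add' hiA hiB, integral_const_mul,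
          integral_const_mul, integral_const_mul, integral_inv_biharmonicSymbol hα hβ]
    _ ≤ t / 2 * (q / p) ^ 2 * p ^ 4 + t / 2 * (p / q) ^ 2 * q ^ 4
        + 1 / (2 * t) * (4 * Real.pi * (q / p) * (p / q))⁻¹ := by gcongr
    _ = s⁻¹ * (p * q) := by
        have h4 : 4 * Real.pi = 2 * s ^ 2 := by rw [hs2]; ring
        rw [h4, ht]
        field_simp
        norm_num

lemma SchwartzMap.norm_le_rpow_mul_rpow (f : 𝓢(E3, ℂ)) (x : E3) :
    ‖f x‖ ≤ (Real.sqrt (2 * Real.pi))⁻¹ *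
      ((∫ ξ, (2 * Real.pi * ‖ξ‖) ^ 2 * ‖𝓕 f ξ‖ ^ 2) ^ ((1 : ℝ) / 4) *
        (∫ ξ, (2 * Real.pi * ‖ξ‖) ^ 4 * ‖𝓕 f ξ‖ ^ 2) ^ ((1 : ℝ) / 4)) := by
  set A := ∫ ξ, (2 * Real.pi * ‖ξ‖) ^ 2 * ‖𝓕 f ξ‖ ^ 2
  set B := ∫ ξ, (2 * Real.pi * ‖ξ‖) ^ 4 * ‖𝓕 f ξ‖ ^ 2
  have hA : 0 ≤ A := integral_nonneg fun ξ => by positivity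
  have hB : 0 ≤ B := integral_nonneg fun ξ => by positivity
  have hpow : ∀ c : ℝ, 0 < c → (c ^ ((1 : ℝ) / 4)) ^ 4 = c := fun c hc => by
    rw [← Real.rpow_natCast, ← Real.rpow_mul hc.le]
    norm_num
  have hcont : Continuous fun ε : ℝ => (Real.sqrt (2 * Real.pi))⁻¹ *
      ((A + ε) ^ ((1 : ℝ) / 4) * (B + ε) ^ ((1 : ℝ) / 4)) := by
    refine continuous_const.mul (Continuous.mul ?_ ?_) <;>
      exact (Real.continuous_rpow_const (by norm_num)).comp (by fun_prop)
  have hlim := (hcont.tendsto 0).mono_left (nhdsWithin_le_nhds (s := Set.Ioi 0))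
  simp only [add_zero] at hlim
  refine ge_of_tendsto hlim ?_
  filter_upwards [self_mem_nhdsWithin] with ε hε
  have hε : 0 < ε := hε
  refine (f.norm_le_integral_norm_fourier x).trans
    (f.integral_norm_fourier_le (by positivity) (by positivity) ?_ ?_)
  · rw [hpow _ (by positivity)]
    exact le_add_of_nonneg_right hε.le
  · rw [hpow _ (by positivity)]
    exact le_add_of_nonneg_right hε.le

lemma fderiv_ofReal_comp_apply {E : Type*} [NormedAddCommGroup E] [NormedSpace ℝ E] {u : E → ℝ}
    {x : E} (hu : DifferentiableAt ℝ u x) (m : E) :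
    fderiv ℝ (fun y => (u y : ℂ)) x m = (fderiv ℝ u x m : ℝ) := by
  have h := (Complex.ofRealCLM.hasFDerivAt.comp x hu.hasFDerivAt).fderiv
  exact congrArg (fun L => L m) h

theorem sup_bound_smooth_compact_support (u : E3 → ℝ)
    (hu : ContDiff ℝ (⊤ : ℕ∞) u) (hc : HasCompactSupport u) :
    ∀ x : E3, |u x| ≤ (Real.sqrt (2 * Real.pi))⁻¹ *
      ((∫ x, ‖gradient u x‖ ^ 2) ^ ((1 : ℝ)/4) * (∫ x, (lap u x) ^ 2) ^ ((1 : ℝ)/4)) := by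
  intro x
  have hc' : HasCompactSupport fun y => (u y : ℂ) := hc.comp_left Complex.ofReal_zero
  let f : 𝓢(E3, ℂ) := hc'.toSchwartzMap (Complex.ofRealCLM.contDiff.comp hu)
  have hf : ⇑f = fun y => (u y : ℂ) := rfl
  let b := EuclideanSpace.basisFun (Fin 3) ℝ
  have hd : ∀ (m y : E3), (∂_{m} f) y = ((fderiv ℝ u y m : ℝ) : ℂ) := fun m y => by
    rw [SchwartzMap.lineDerivOp_apply_eq_fderiv, hf]
    exact fderiv_ofReal_comp_apply (hu.differentiable (by simp) y) m
  have hdd : ∀ (m y : E3),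
      (∂_{m} (∂_{m} f)) y = ((fderiv ℝ (fun z => fderiv ℝ u z m) y m : ℝ) : ℂ) := fun m y => by
    rw [SchwartzMap.lineDerivOp_apply_eq_fderiv, funext (hd m)]
    refine fderiv_ofReal_comp_apply ?_ m
    exact ((hu.fderiv_right (m := 1) (by norm_cast)).clm_apply contDiff_const).differentiable
      one_ne_zero y
  have hgrad : ∀ y, ∑ i, ‖(∂_{b i} f) y‖ ^ 2 = ‖gradient u y‖ ^ 2 := fun y => by
    rw [← b.sum_sq_norm_inner_left (gradient u y)]
    simp [hd, inner_gradient_left]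
  have hlap : ∀ y, ‖(∑ i, ∂_{b i} (∂_{b i} f)) y‖ ^ 2 = (lap u y) ^ 2 := fun y => by
    rw [sum_apply]
    simp_rw [hdd]
    rw [← Complex.ofReal_sum, Complex.norm_real, Real.norm_eq_abs, sq_abs]
    simp [lap, b]
  have h := f.norm_le_rpow_mul_rpow x
  rw [f.integral_norm_sq_fourier_sq b, f.integral_norm_pow_four_fourier_sq b] at h
  simp_rw [hgrad, hlap] at h
  simpa [hf] using h
end
end

section
/- For any open set Ω ⊂ ℝ³, the constant (2π)^{-1/2} in the inequality sup_Ω|u| ≤ C ‖∇u‖^{1/2}‖Δu‖^{1/2} over u ∈ C_c^∞(Ω) is optimal: there exists a sequence u_n ∈ C_c^∞(Ω) with sup|u_n| / (‖∇u_n‖^{1/2}‖Δu_n‖^{1/2}) → (2π)^{-1/2}. -/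
open MeasureTheory Filter

noncomputable section

/-- `φ` is a smooth compactly supported test function with support inside `Ω`. -/
def IsTestOn (Ω : Set E3) (φ : E3 → ℝ) : Prop :=
  ContDiff ℝ (⊤ : ℕ∞) φ ∧ HasCompactSupport φ ∧ tsupport φ ⊆ Ω

section Radial

variable {φ φ₁ φ₂ : ℝ → ℝ} {δ : ℝ}

/-- The smoothed absolute value `√(r² + δ²)`. -/
def smoothAbs (δ r : ℝ) : ℝ := √(r ^ 2 + δ ^ 2)

/-- The smoothed distance `√(‖x‖² + δ²)` to the origin. -/
def smoothNorm (δ : ℝ) (x : E3) : ℝ := smoothAbs δ ‖x‖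

lemma smoothAbs_pos (hδ : 0 < δ) (r : ℝ) : 0 < smoothAbs δ r :=
  Real.sqrt_pos.2 (by positivity)

lemma le_smoothAbs (δ r : ℝ) : r ≤ smoothAbs δ r :=
  Real.le_sqrt_of_sq_le (by nlinarith [sq_nonneg δ])

lemma smoothNorm_pos (hδ : 0 < δ) (x : E3) : 0 < smoothNorm δ x :=
  smoothAbs_pos hδ _

lemma hasFDerivAt_smoothNorm (hδ : 0 < δ) (x : E3) :
    HasFDerivAt (smoothNorm δ) ((smoothNorm δ x)⁻¹ • innerSL ℝ x) x := by
  have hne : ‖x‖ ^ 2 + δ ^ 2 ≠ 0 := by positivity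
  have h := ((hasStrictFDerivAt_norm_sq x).hasFDerivAt.add_const (δ ^ 2)).sqrt hne
  refine h.congr_fderiv ?_
  ext y
  simp [smoothNorm, smoothAbs]
  field_simp

lemma contDiff_smoothNorm (hδ : 0 < δ) : ContDiff ℝ (⊤ : ℕ∞) (smoothNorm δ) :=
  ((contDiff_norm_sq ℝ).add contDiff_const).sqrt fun x => by positivity

lemma hasFDerivAt_comp_smoothNorm (hδ : 0 < δ) (h₁ : ∀ s, 0 < s → HasDerivAt φ (φ₁ s) s)
    (x : E3) :
    HasFDerivAt (fun y => φ (smoothNorm δ y))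
      ((φ₁ (smoothNorm δ x) / smoothNorm δ x) • innerSL ℝ x) x := by
  have h := (h₁ _ (smoothNorm_pos hδ x)).comp_hasFDerivAt x (hasFDerivAt_smoothNorm hδ x)
  refine h.congr_fderiv ?_
  rw [smul_smul, div_eq_mul_inv]

lemma norm_gradient_comp_smoothNorm (hδ : 0 < δ)
    (h₁ : ∀ s, 0 < s → HasDerivAt φ (φ₁ s) s) (x : E3) :
    ‖gradient (fun y => φ (smoothNorm δ y)) x‖ ^ 2 =
      (φ₁ (smoothNorm δ x) / smoothNorm δ x * ‖x‖) ^ 2 := by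
  rw [gradient, LinearIsometryEquiv.norm_map, (hasFDerivAt_comp_smoothNorm hδ h₁ x).fderiv,
    norm_smul, innerSL_apply_norm, mul_pow, mul_pow, Real.norm_eq_abs, sq_abs]

lemma lap_comp_smoothNorm (hδ : 0 < δ) (h₁ : ∀ s, 0 < s → HasDerivAt φ (φ₁ s) s)
    (h₂ : ∀ s, 0 < s → HasDerivAt φ₁ (φ₂ s) s) (x : E3) :
    lap (fun y => φ (smoothNorm δ y)) x =
      ‖x‖ ^ 2 / smoothNorm δ x ^ 2 * φ₂ (smoothNorm δ x) + φ₁ (smoothNorm δ x) *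
        (3 / smoothNorm δ x - ‖x‖ ^ 2 / smoothNorm δ x ^ 3) := by
  have hs := smoothNorm_pos hδ x
  have hquot : ∀ s, 0 < s → HasDerivAt (fun s => φ₁ s / s) (φ₂ s / s - φ₁ s / s ^ 2) s := by
    intro s hs
    refine ((h₂ s hs).div (hasDerivAt_id s) hs.ne').congr_deriv ?_
    simp only [id]
    field_simp
  have key : ∀ i : Fin 3, fderiv ℝ (fun y => fderiv ℝ (fun y => φ (smoothNorm δ y)) y
      (EuclideanSpace.single i 1)) x (EuclideanSpace.single i 1) =
      (φ₂ (smoothNorm δ x) / smoothNorm δ x - φ₁ (smoothNorm δ x) / smoothNorm δ x ^ 2) /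
        smoothNorm δ x * x i ^ 2 + φ₁ (smoothNorm δ x) / smoothNorm δ x := by
    intro i
    have hfun : (fun y => fderiv ℝ (fun y => φ (smoothNorm δ y)) y
        (EuclideanSpace.single i 1)) =
        fun y => φ₁ (smoothNorm δ y) / smoothNorm δ y * EuclideanSpace.proj (𝕜 := ℝ) i y := by
      funext y
      rw [(hasFDerivAt_comp_smoothNorm hδ h₁ y).fderiv]
      simp [EuclideanSpace.inner_single_right]
    have hd : HasFDerivAt (fun y => φ₁ (smoothNorm δ y) / smoothNorm δ y *
        EuclideanSpace.proj (𝕜 := ℝ) i y) _ x := (hasFDerivAt_comp_smoothNorm hδ hquot x).mul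
      (EuclideanSpace.proj i : E3 →L[ℝ] ℝ).hasFDerivAt
    rw [hfun, hd.fderiv]
    simp [EuclideanSpace.inner_single_right]
    ring
  have hnorm : ‖x‖ ^ 2 = x 0 ^ 2 + x 1 ^ 2 + x 2 ^ 2 := by
    rw [EuclideanSpace.real_norm_sq_eq, Fin.sum_univ_three]
  rw [lap, Finset.sum_congr rfl fun i _ => key i, Fin.sum_univ_three, hnorm]
  field_simp
  ring

lemma integral_comp_norm (g : ℝ → ℝ) :
    ∫ x : E3, g ‖x‖ = 4 * Real.pi * ∫ r in Set.Ioi 0, r ^ 2 * g r := by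
  rw [integral_fun_norm_addHaar volume g]
  simp only [finrank_euclideanSpace, Fintype.card_fin, Measure.real, smul_eq_mul,
    EuclideanSpace.volume_ball_fin_three, nsmul_eq_mul]
  rw [ENNReal.ofReal_one, one_pow, one_mul, ENNReal.toReal_ofReal (by positivity)]
  norm_num
  ring

end Radial

section Scaling

variable {u : E3 → ℝ} {l : ℝ}

lemma fderiv_comp_dilation (hu : Differentiable ℝ u) (l : ℝ) (x₀ x : E3) :
    fderiv ℝ (fun y => u (l • (y - x₀))) x = l • fderiv ℝ u (l • (x - x₀)) := by
  have h := (hu (l • (x - x₀))).hasFDerivAt.comp x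
    (((hasFDerivAt_id x).sub_const x₀).const_smul l)
  refine h.fderiv.trans ?_
  ext y
  simp

lemma lap_comp_dilation (hu : ContDiff ℝ (⊤ : ℕ∞) u) (l : ℝ) (x₀ x : E3) :
    lap (fun y => u (l • (y - x₀))) x = l ^ 2 * lap u (l • (x - x₀)) := by
  rw [lap, lap, Finset.mul_sum]
  refine Finset.sum_congr rfl fun i _ => ?_
  have hu' : Differentiable ℝ (fun z => fderiv ℝ u z (EuclideanSpace.single i (1 : ℝ))) :=
    ((hu.fderiv_right (m := 1) (WithTop.coe_le_coe.2 le_top)).clm_apply contDiff_const).differentiable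
      one_ne_zero
  have hfun : (fun y => fderiv ℝ (fun y => u (l • (y - x₀))) y (EuclideanSpace.single i (1 : ℝ))) =
      fun y => l • (fun z => fderiv ℝ u z (EuclideanSpace.single i (1 : ℝ))) (l • (y - x₀)) := by
    funext y
    rw [fderiv_comp_dilation (hu.differentiable (by simp))]
    rfl
  rw [hfun, fderiv_fun_const_smul, fderiv_comp_dilation hu']
  · simp
    ring
  · exact (hu'.comp ((differentiable_id.sub_const x₀).const_smul l)) x

lemma integral_comp_dilation (hl : 0 < l) (g : E3 → ℝ) (x₀ : E3) :
    ∫ x, g (l • (x - x₀)) = (l ^ 3)⁻¹ * ∫ x, g x := by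
  rw [integral_sub_right_eq_self (fun x => g (l • x)) x₀, Measure.integral_comp_smul]
  simp [abs_of_pos hl]

/-- The quotient `sup |u| / (‖∇u‖^(1/2) ‖Δu‖^(1/2))`. -/
def agmonQuotient (u : E3 → ℝ) : ℝ :=
  (⨆ x, |u x|) / ((∫ x, ‖gradient u x‖ ^ 2) ^ ((1 : ℝ) / 4) *
    (∫ x, (lap u x) ^ 2) ^ ((1 : ℝ) / 4))

lemma agmonQuotient_comp_dilation (hu : ContDiff ℝ (⊤ : ℕ∞) u) (hl : 0 < l) (x₀ : E3) :
    agmonQuotient (fun y => u (l • (y - x₀))) = agmonQuotient u := by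
  have hsup : (⨆ x, |u (l • (x - x₀))|) = ⨆ x, |u x| := by
    refine Function.Surjective.iSup_comp (f := fun x : E3 => l • (x - x₀)) (fun y => ?_)
      (fun y => |u y|)
    exact ⟨l⁻¹ • y + x₀, by simp [smul_smul, hl.ne']⟩
  have hgrad : ∫ x, ‖gradient (fun y => u (l • (y - x₀))) x‖ ^ 2 =
      l⁻¹ * ∫ x, ‖gradient u x‖ ^ 2 := by
    have : ∀ x, ‖gradient (fun y => u (l • (y - x₀))) x‖ ^ 2 =
        l ^ 2 * ‖gradient u (l • (x - x₀))‖ ^ 2 := by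
      intro x
      simp only [gradient, LinearIsometryEquiv.norm_map]
      rw [fderiv_comp_dilation (hu.differentiable (by simp)), norm_smul, mul_pow,
        Real.norm_eq_abs, sq_abs]
    simp_rw [this]
    rw [integral_const_mul, integral_comp_dilation hl fun x => ‖gradient u x‖ ^ 2]
    field_simp
  have hlap : ∫ x, (lap (fun y => u (l • (y - x₀))) x) ^ 2 = l * ∫ x, (lap u x) ^ 2 := by
    simp_rw [lap_comp_dilation hu, mul_pow]
    rw [integral_const_mul, integral_comp_dilation hl fun x => lap u x ^ 2]
    field_simp
  have hA : 0 ≤ ∫ x, ‖gradient u x‖ ^ 2 := integral_nonneg fun x => by positivity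
  have hB : 0 ≤ ∫ x, (lap u x) ^ 2 := integral_nonneg fun x => by positivity
  rw [agmonQuotient, agmonQuotient, hsup, hgrad, hlap, ← Real.mul_rpow (by positivity)
    (by positivity), ← Real.mul_rpow hA hB]
  congr 2
  field_simp

lemma exists_isTestOn_comp_dilation {Ω : Set E3} (hΩ : IsOpen Ω) (hne : Ω.Nonempty)
    (hu : ContDiff ℝ (⊤ : ℕ∞) u) (hc : HasCompactSupport u) :
    ∃ l : ℝ, 0 < l ∧ ∃ x₀, IsTestOn Ω (fun y => u (l • (y - x₀))) := by
  obtain ⟨x₀, hx₀⟩ := hne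
  obtain ⟨ρ, hρ, hball⟩ := Metric.isOpen_iff.1 hΩ x₀ hx₀
  obtain ⟨C, hC, hsupp⟩ := hc.isCompact.isBounded.exists_pos_norm_le
  have hl : 0 < 2 * C / ρ := by positivity
  have hts : tsupport (fun y => u ((2 * C / ρ) • (y - x₀))) ⊆ Metric.closedBall x₀ (ρ / 2) := by
    refine closure_minimal (fun y hy => ?_) Metric.isClosed_closedBall
    have h := hsupp _ (subset_tsupport u hy)
    rw [norm_smul, Real.norm_of_nonneg hl.le, div_mul_eq_mul_div, div_le_iff₀ hρ] at h
    rw [mem_closedBall_iff_norm]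
    nlinarith
  refine ⟨2 * C / ρ, hl, x₀, ?_, ?_, ?_⟩
  · exact hu.comp ((contDiff_id.sub contDiff_const).const_smul _)
  · exact (isCompact_closedBall x₀ (ρ / 2)).of_isClosed_subset (isClosed_tsupport _) hts
  · exact (hts.trans (Metric.closedBall_subset_ball (by linarith))).trans hball

end Scaling

section Profile

open Topology Real

/-- The radial profile of the extremal function. -/
def profile (s : ℝ) : ℝ := (1 - exp (-s)) / s

/-- The derivative of `profile`. -/
def profileDeriv (s : ℝ) : ℝ := (exp (-s) - profile s) / s

/-- The second derivative of `profile`. -/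
def profileDeriv₂ (s : ℝ) : ℝ := (-exp (-s) - 2 * profileDeriv s) / s

lemma hasDerivAt_exp_neg (s : ℝ) : HasDerivAt (fun s => exp (-s)) (-exp (-s)) s := by
  simpa using (hasDerivAt_neg s).exp

lemma hasDerivAt_profile {s : ℝ} (hs : s ≠ 0) : HasDerivAt profile (profileDeriv s) s := by
  refine (((hasDerivAt_exp_neg s).const_sub 1).div (hasDerivAt_id s) hs).congr_deriv ?_
  simp only [id, profileDeriv, profile]
  field_simp

lemma hasDerivAt_profileDeriv {s : ℝ} (hs : s ≠ 0) :
    HasDerivAt profileDeriv (profileDeriv₂ s) s := by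
  refine (((hasDerivAt_exp_neg s).sub (hasDerivAt_profile hs)).div
    (hasDerivAt_id s) hs).congr_deriv ?_
  simp only [id, profileDeriv₂, profileDeriv, Pi.sub_apply]
  field_simp
  ring

lemma profile_mul_self {s : ℝ} (hs : s ≠ 0) : s * profile s = 1 - exp (-s) := by
  rw [profile, mul_div_cancel₀ _ hs]

lemma self_mul_profileDeriv {s : ℝ} (hs : s ≠ 0) :
    s * profileDeriv s = exp (-s) - profile s := by
  rw [profileDeriv, mul_div_cancel₀ _ hs]

lemma self_mul_profileDeriv₂ {s : ℝ} (hs : s ≠ 0) :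
    s * profileDeriv₂ s = -exp (-s) - 2 * profileDeriv s := by
  rw [profileDeriv₂, mul_div_cancel₀ _ hs]

lemma exp_neg_mul_le (s : ℝ) : exp (-s) * (1 + s) ≤ 1 := by
  rw [exp_neg, inv_mul_le_iff₀ (exp_pos s)]
  linarith [add_one_le_exp s]

lemma one_sub_exp_neg_mem {s : ℝ} (hs : 0 < s) : 0 ≤ 1 - exp (-s) ∧ 1 - exp (-s) ≤ 1 :=
  ⟨by simpa using hs.le, by linarith [exp_pos (-s)]⟩

lemma profile_nonneg {s : ℝ} (hs : 0 < s) : 0 ≤ profile s :=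
  div_nonneg (one_sub_exp_neg_mem hs).1 hs.le

lemma profile_le_one {s : ℝ} (hs : 0 < s) : profile s ≤ 1 := by
  rw [profile, div_le_one hs]
  linarith [one_sub_le_exp_neg s]

lemma profile_mul_le {s : ℝ} (hs : 0 < s) : profile s * (1 + s) ≤ 2 := by
  have h := profile_mul_self hs.ne'
  nlinarith [profile_le_one hs, (one_sub_exp_neg_mem hs).2]

lemma abs_self_mul_profileDeriv_mul_le {s : ℝ} (hs : 0 < s) :
    |s * profileDeriv s| * (1 + s) ≤ 2 := by
  rw [self_mul_profileDeriv hs.ne', ← abs_of_pos (by linarith : 0 < 1 + s), ← abs_mul, abs_le]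
  constructor <;> nlinarith [exp_neg_mul_le s, profile_mul_le hs, profile_nonneg hs, exp_pos (-s),
    mul_pos (exp_pos (-s)) hs, mul_nonneg (profile_nonneg hs) hs.le]

lemma abs_profileDeriv_le_one {s : ℝ} (hs : 0 < s) : |profileDeriv s| ≤ 1 := by
  have h : s ^ 2 * profileDeriv s = s * exp (-s) - (1 - exp (-s)) := by
    rw [← profile_mul_self hs.ne', pow_two, mul_assoc, self_mul_profileDeriv hs.ne']
    ring
  have h₁ : exp (-s) * (1 + s) ≤ 1 := exp_neg_mul_le s
  have h₂ : (1 - s) * (1 + s) ≤ exp (-s) * (1 + s) :=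
    mul_le_mul_of_nonneg_right (one_sub_le_exp_neg s) (by linarith)
  have h₃ : 0 < s ^ 2 := by positivity
  rw [abs_le]
  constructor <;> nlinarith

lemma abs_profileDeriv_mul_le {s : ℝ} (hs : 0 < s) : |profileDeriv s| * (1 + s) ≤ 3 := by
  have h := abs_self_mul_profileDeriv_mul_le hs
  rw [abs_mul, abs_of_pos hs] at h
  nlinarith [abs_profileDeriv_le_one hs, abs_nonneg (profileDeriv s),
    mul_nonneg (abs_nonneg (profileDeriv s)) (sq_nonneg s)]

lemma abs_self_mul_profileDeriv₂_mul_le {s : ℝ} (hs : 0 < s) :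
    |s * profileDeriv₂ s| * (1 + s) ≤ 7 := by
  have h : |s * profileDeriv₂ s| ≤ exp (-s) + 2 * |profileDeriv s| := by
    rw [self_mul_profileDeriv₂ hs.ne']
    refine (abs_sub _ _).trans_eq ?_
    rw [abs_neg, abs_of_pos (exp_pos _), abs_mul, abs_two]
  nlinarith [exp_neg_mul_le s, abs_profileDeriv_mul_le hs]

lemma tendsto_profile_zero : Tendsto profile (𝓝[>] 0) (𝓝 1) := by
  have h := ((hasDerivAt_exp_neg 0).const_sub 1).tendsto_slope.mono_left
    (nhdsWithin_mono _ fun x (hx : 0 < x) => hx.ne')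
  simp only [neg_zero, exp_zero, neg_neg] at h
  refine h.congr fun s => ?_
  simp [slope_def_field, profile]

/-- A smooth cutoff function on the line. -/
def cutoff : ContDiffBump (0 : ℝ) := ⟨1, 2, one_pos, one_lt_two⟩

lemma contDiff_cutoff : ContDiff ℝ (⊤ : ℕ∞) cutoff := cutoff.contDiff

lemma contDiff_deriv_cutoff : ContDiff ℝ (⊤ : ℕ∞) (deriv cutoff) :=
  (contDiff_infty_iff_deriv.1 contDiff_cutoff).2

lemma contDiff_deriv_deriv_cutoff : ContDiff ℝ (⊤ : ℕ∞) (deriv (deriv cutoff)) :=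
  (contDiff_infty_iff_deriv.1 contDiff_deriv_cutoff).2

lemma hasDerivAt_cutoff (t : ℝ) : HasDerivAt cutoff (deriv cutoff t) t :=
  (contDiff_cutoff.differentiable (by simp) t).hasDerivAt

lemma hasDerivAt_deriv_cutoff (t : ℝ) :
    HasDerivAt (deriv cutoff) (deriv (deriv cutoff) t) t :=
  (contDiff_deriv_cutoff.differentiable (by simp) t).hasDerivAt

lemma cutoff_zero : cutoff 0 = 1 :=
  cutoff.one_of_mem_closedBall (Metric.mem_closedBall_self cutoff.rIn_pos.le)

lemma abs_cutoff_le_one (t : ℝ) : |cutoff t| ≤ 1 := by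
  rw [abs_of_nonneg cutoff.nonneg]
  exact cutoff.le_one

lemma HasCompactSupport.exists_mul_one_add_le {g : ℝ → ℝ} (hg : Continuous g)
    (hc : HasCompactSupport g) : ∃ M, 0 ≤ M ∧ ∀ t, 0 < t → |g t| * (1 + t) ≤ M := by
  obtain ⟨M, hM⟩ := (hc.mul_right (f' := fun t => 1 + t)).exists_bound_of_continuous
    (hg.mul (continuous_const.add continuous_id))
  refine ⟨M, (norm_nonneg _).trans (hM 0), fun t ht => ?_⟩
  simpa [abs_mul, abs_of_pos (by linarith : 0 < 1 + t)] using hM t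

lemma exists_cutoff_bound : ∃ M, 0 ≤ M ∧ ∀ t, 0 < t →
    |deriv cutoff t| * (1 + t) ≤ M ∧ |deriv (deriv cutoff) t| * (1 + t) ≤ M := by
  have hc : HasCompactSupport cutoff := cutoff.hasCompactSupport
  obtain ⟨M₁, h₁, hM₁⟩ := hc.deriv.exists_mul_one_add_le contDiff_deriv_cutoff.continuous
  obtain ⟨M₂, h₂, hM₂⟩ := hc.deriv.deriv.exists_mul_one_add_le
    contDiff_deriv_deriv_cutoff.continuous
  exact ⟨max M₁ M₂, h₁.trans (le_max_left _ _), fun t ht =>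
    ⟨(hM₁ t ht).trans (le_max_left _ _), (hM₂ t ht).trans (le_max_right _ _)⟩⟩

/-- The truncation of `profile` at scale `R`. -/
def truncProfile (R s : ℝ) : ℝ := profile s * cutoff (s / R)

/-- The derivative of `truncProfile R`. -/
def truncProfileDeriv (R s : ℝ) : ℝ :=
  profileDeriv s * cutoff (s / R) + profile s * (deriv cutoff (s / R) / R)

/-- The second derivative of `truncProfile R`. -/
def truncProfileDeriv₂ (R s : ℝ) : ℝ :=
  profileDeriv₂ s * cutoff (s / R) + 2 * (profileDeriv s * (deriv cutoff (s / R) / R)) +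
    profile s * (deriv (deriv cutoff) (s / R) / R ^ 2)

lemma hasDerivAt_truncProfile (R : ℝ) {s : ℝ} (hs : s ≠ 0) :
    HasDerivAt (truncProfile R) (truncProfileDeriv R s) s := by
  refine ((hasDerivAt_profile hs).mul ((hasDerivAt_cutoff (s / R)).comp s
    ((hasDerivAt_id s).div_const R))).congr_deriv ?_
  simp only [truncProfileDeriv, id, Function.comp_apply]
  ring

lemma hasDerivAt_truncProfileDeriv (R : ℝ) {s : ℝ} (hs : s ≠ 0) :
    HasDerivAt (truncProfileDeriv R) (truncProfileDeriv₂ R s) s := by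
  refine (((hasDerivAt_profileDeriv hs).mul ((hasDerivAt_cutoff (s / R)).comp s
    ((hasDerivAt_id s).div_const R))).add ((hasDerivAt_profile hs).mul
    (((hasDerivAt_deriv_cutoff (s / R)).comp s
      ((hasDerivAt_id s).div_const R)).div_const R))).congr_deriv ?_
  simp only [truncProfileDeriv₂, id, Function.comp_apply]
  ring

lemma abs_comp_div_mul_le {g : ℝ → ℝ} {M R s : ℝ} (hg : ∀ t, 0 < t → |g t| * (1 + t) ≤ M)
    (hR : 1 ≤ R) (hs : 0 < s) : |g (s / R) / R| * (1 + s) ≤ M := by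
  have hR0 : 0 < R := by linarith
  refine le_trans ?_ (hg (s / R) (by positivity))
  rw [abs_div, abs_of_pos hR0, div_mul_eq_mul_div, mul_div_assoc]
  refine mul_le_mul_of_nonneg_left ?_ (abs_nonneg _)
  rw [add_div]
  gcongr
  exact (div_le_one hR0).2 hR

lemma exists_truncProfile_bound : ∃ C, 0 ≤ C ∧ ∀ R s, 1 ≤ R → 0 < s →
    |truncProfileDeriv R s| * (1 + s) ≤ C ∧ |s * truncProfileDeriv R s| * (1 + s) ≤ C ∧
      |s * truncProfileDeriv₂ R s| * (1 + s) ≤ C := by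
  obtain ⟨M, hM, hbd⟩ := exists_cutoff_bound
  refine ⟨7 + 5 * M, by positivity, fun R s hR hs => ?_⟩
  have hs1 : 0 < 1 + s := by linarith
  have hR0 : 0 < R := by linarith
  have hχ := abs_cutoff_le_one (s / R)
  have hχ₁ : |deriv cutoff (s / R) / R| * (1 + s) ≤ M :=
    abs_comp_div_mul_le (fun t ht => (hbd t ht).1) hR hs
  have hχ₂ : |deriv (deriv cutoff) (s / R) / R ^ 2| * (1 + s) ≤ M := by
    have h := abs_comp_div_mul_le (fun t ht => (hbd t ht).2) hR hs
    refine le_trans (mul_le_mul_of_nonneg_right ?_ hs1.le) h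
    rw [abs_div, abs_div, abs_of_pos hR0, abs_of_pos (by positivity : 0 < R ^ 2)]
    gcongr
    nlinarith
  have hf : |profile s| ≤ 1 := by
    rw [abs_of_nonneg (profile_nonneg hs)]
    exact profile_le_one hs
  have hsf : |s * profile s| ≤ 1 := by
    rw [profile_mul_self hs.ne', abs_of_nonneg (one_sub_exp_neg_mem hs).1]
    exact (one_sub_exp_neg_mem hs).2
  have hf₁ := abs_profileDeriv_mul_le hs
  have hsf₁ := abs_self_mul_profileDeriv_mul_le hs
  have hsf₁' : |s * profileDeriv s| ≤ 2 := by nlinarith [abs_nonneg (s * profileDeriv s)]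
  have hsf₂ := abs_self_mul_profileDeriv₂_mul_le hs
  have left_bound : ∀ {a b A : ℝ}, |a| * (1 + s) ≤ A → |b| ≤ 1 → |a * b| * (1 + s) ≤ A := by
    intro a b A ha hb
    rw [abs_mul]
    nlinarith [abs_nonneg a, mul_nonneg (abs_nonneg a) hs1.le]
  have right_bound : ∀ {a b A : ℝ}, |a| ≤ A → |b| * (1 + s) ≤ M → |a * b| * (1 + s) ≤ A * M := by
    intro a b A ha hb
    rw [abs_mul, mul_assoc]
    exact mul_le_mul ha hb (by positivity) ((abs_nonneg a).trans ha)
  refine ⟨?_, ?_, ?_⟩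
  · have h := mul_le_mul_of_nonneg_right (abs_add_le (profileDeriv s * cutoff (s / R))
      (profile s * (deriv cutoff (s / R) / R))) hs1.le
    rw [truncProfileDeriv]
    linarith [left_bound hf₁ hχ, right_bound hf hχ₁]
  · have h := mul_le_mul_of_nonneg_right (abs_add_le (s * profileDeriv s * cutoff (s / R))
      (s * profile s * (deriv cutoff (s / R) / R))) hs1.le
    have e : s * truncProfileDeriv R s = s * profileDeriv s * cutoff (s / R) +
        s * profile s * (deriv cutoff (s / R) / R) := by
      rw [truncProfileDeriv]
      ring
    rw [e]
    linarith [left_bound hsf₁ hχ, right_bound hsf hχ₁]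
  · have h := mul_le_mul_of_nonneg_right (abs_add_three (s * profileDeriv₂ s * cutoff (s / R))
      (2 * (s * profileDeriv s * (deriv cutoff (s / R) / R)))
      (s * profile s * (deriv (deriv cutoff) (s / R) / R ^ 2))) hs1.le
    rw [abs_mul 2, abs_two] at h
    have e : s * truncProfileDeriv₂ R s = s * profileDeriv₂ s * cutoff (s / R) +
        2 * (s * profileDeriv s * (deriv cutoff (s / R) / R)) +
        s * profile s * (deriv (deriv cutoff) (s / R) / R ^ 2) := by
      rw [truncProfileDeriv₂]
      ring
    rw [e]
    linarith [left_bound hsf₂ hχ, right_bound hsf₁' hχ₁, right_bound hsf hχ₂]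

end Profile

section Limits

open Topology Real

lemma integral_exp_neg_sub_profile_sq :
    ∫ r in Set.Ioi 0, (exp (-r) - profile r) ^ 2 = 1 / 2 := by
  have hexp : Tendsto (fun r : ℝ => exp (-r)) atTop (𝓝 0) := tendsto_exp_neg_atTop_nhds_zero
  have hcont : ContinuousWithinAt (fun r => -(exp (-r)) ^ 2 / 2 - (1 - exp (-r)) * profile r)
      (Set.Ici 0) 0 := by
    rw [← continuousWithinAt_Ioi_iff_Ici, ContinuousWithinAt]
    have h : Tendsto (fun r : ℝ => exp (-r)) (𝓝[>] 0) (𝓝 1) := by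
      have : Continuous fun r : ℝ => exp (-r) := by fun_prop
      simpa using this.tendsto' 0 1 (by simp) |>.mono_left nhdsWithin_le_nhds
    simpa using ((h.pow 2).neg.div_const 2).sub ((h.const_sub 1).mul tendsto_profile_zero)
  have hlim : Tendsto (fun r => -(exp (-r)) ^ 2 / 2 - (1 - exp (-r)) * profile r)
      atTop (𝓝 0) := by
    have hp : Tendsto profile atTop (𝓝 0) := (hexp.const_sub 1).div_atTop tendsto_id
    simpa using ((hexp.pow 2).neg.div_const 2).sub ((hexp.const_sub 1).mul hp)
  rw [integral_Ioi_of_hasDerivAt_of_nonneg hcont (fun r hr => ?_) (fun r _ => sq_nonneg _) hlim]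
  · norm_num
  have hr0 : r ≠ 0 := (show (0 : ℝ) < r from hr).ne'
  refine (((((hasDerivAt_exp_neg r).pow 2).neg).div_const 2).sub
    (((hasDerivAt_exp_neg r).const_sub 1).mul (hasDerivAt_profile hr0))).congr_deriv ?_
  have h₁ : (1 - exp (-r)) * profileDeriv r = profile r * (exp (-r) - profile r) := by
    rw [← profile_mul_self hr0, ← self_mul_profileDeriv hr0]
    ring
  rw [h₁]
  ring

lemma integral_exp_neg_sq : ∫ r in Set.Ioi (0 : ℝ), (-exp (-r)) ^ 2 = 1 / 2 := by
  have hexp : Tendsto (fun r : ℝ => exp (-r)) atTop (𝓝 0) := tendsto_exp_neg_atTop_nhds_zero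
  rw [integral_Ioi_of_hasDerivAt_of_nonneg' (g := fun r => -(exp (-r)) ^ 2 / 2) (l := 0)
    (fun r _ => ?_) (fun r _ => sq_nonneg _) (by simpa using (hexp.pow 2).neg.div_const 2)]
  · norm_num
  · refine ((((hasDerivAt_exp_neg r).pow 2).neg).div_const 2).congr_deriv ?_
    ring

lemma tendsto_integral_sq_of_le {F : ℕ → ℝ → ℝ} {G : ℝ → ℝ} {C : ℝ}
    (hF : ∀ n, Measurable (F n)) (hC : ∀ n r, 0 < r → |F n r| * (1 + r) ≤ C)
    (hlim : ∀ r, 0 < r → Tendsto (fun n => F n r) atTop (𝓝 (G r))) :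
    Tendsto (fun n => ∫ r in Set.Ioi 0, F n r ^ 2) atTop (𝓝 (∫ r in Set.Ioi 0, G r ^ 2)) := by
  refine tendsto_integral_of_dominated_convergence (fun r => C ^ 2 * (1 + r ^ 2)⁻¹)
    (fun n => ((hF n).pow_const 2).aestronglyMeasurable)
    (integrable_inv_one_add_sq.const_mul _).restrict (fun n => ?_) ?_
  · filter_upwards [ae_restrict_mem measurableSet_Ioi] with r hr
    have hr0 : 0 < r := hr
    rw [norm_of_nonneg (sq_nonneg _), ← div_eq_mul_inv, le_div_iff₀ (by positivity), ← sq_abs]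
    have h := pow_le_pow_left₀ (by positivity) (hC n r hr0) 2
    nlinarith [sq_nonneg |F n r|, mul_nonneg (sq_nonneg |F n r|) hr0.le]
  · filter_upwards [ae_restrict_mem measurableSet_Ioi] with r hr
    exact (hlim r hr).pow 2

section Pointwise

variable {R s : ℕ → ℝ} {r : ℝ}

lemma tendsto_comp_div {g : ℝ → ℝ} (hg : Continuous g) (hR : Tendsto R atTop atTop)
    (hs : Tendsto s atTop (𝓝 r)) : Tendsto (fun n => g (s n / R n)) atTop (𝓝 (g 0)) :=
  (hg.tendsto 0).comp (hs.div_atTop hR)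

lemma tendsto_truncProfileDeriv (hr : r ≠ 0) (hR : Tendsto R atTop atTop)
    (hs : Tendsto s atTop (𝓝 r)) :
    Tendsto (fun n => truncProfileDeriv (R n) (s n)) atTop (𝓝 (profileDeriv r)) := by
  have hf := (hasDerivAt_profile hr).continuousAt.tendsto.comp hs
  have hf₁ := (hasDerivAt_profileDeriv hr).continuousAt.tendsto.comp hs
  have hχ := tendsto_comp_div contDiff_cutoff.continuous hR hs
  have hχ₁ := (tendsto_comp_div contDiff_deriv_cutoff.continuous hR hs).div_atTop hR
  rw [cutoff_zero] at hχ
  simpa [truncProfileDeriv] using (hf₁.mul hχ).add (hf.mul hχ₁)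

lemma tendsto_truncProfileDeriv₂ (hr : r ≠ 0) (hR : Tendsto R atTop atTop)
    (hs : Tendsto s atTop (𝓝 r)) :
    Tendsto (fun n => truncProfileDeriv₂ (R n) (s n)) atTop (𝓝 (profileDeriv₂ r)) := by
  have hf := (hasDerivAt_profile hr).continuousAt.tendsto.comp hs
  have hf₁ := (hasDerivAt_profileDeriv hr).continuousAt.tendsto.comp hs
  have hf₂ : Tendsto (fun n => profileDeriv₂ (s n)) atTop (𝓝 (profileDeriv₂ r)) :=
    (((hasDerivAt_exp_neg r).continuousAt.tendsto.comp hs).neg.sub (hf₁.const_mul 2)).div hs hr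
  have hχ := tendsto_comp_div contDiff_cutoff.continuous hR hs
  have hχ₁ := (tendsto_comp_div contDiff_deriv_cutoff.continuous hR hs).div_atTop hR
  have hχ₂ := (tendsto_comp_div contDiff_deriv_deriv_cutoff.continuous hR hs).div_atTop
    ((tendsto_pow_atTop two_ne_zero).comp hR)
  rw [cutoff_zero] at hχ
  simpa [truncProfileDeriv₂] using ((hf₂.mul hχ).add ((hf₁.mul hχ₁).const_mul 2)).add (hf.mul hχ₂)

end Pointwise

lemma measurable_truncProfileDeriv (R : ℝ) : Measurable (truncProfileDeriv R) := by
  have h₀ := contDiff_cutoff.continuous.measurable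
  have h₁ := contDiff_deriv_cutoff.continuous.measurable
  unfold truncProfileDeriv profileDeriv profile
  fun_prop

lemma measurable_truncProfileDeriv₂ (R : ℝ) : Measurable (truncProfileDeriv₂ R) := by
  have h₀ := contDiff_cutoff.continuous.measurable
  have h₁ := contDiff_deriv_cutoff.continuous.measurable
  have h₂ := contDiff_deriv_deriv_cutoff.continuous.measurable
  unfold truncProfileDeriv₂ profileDeriv₂ profileDeriv profile
  fun_prop

lemma measurable_smoothAbs (δ : ℝ) : Measurable (smoothAbs δ) := by
  unfold smoothAbs
  fun_prop

lemma tendsto_smoothAbs {R : ℕ → ℝ} (hR : Tendsto R atTop atTop) {r : ℝ} (hr : 0 ≤ r) :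
    Tendsto (fun n => smoothAbs (R n)⁻¹ r) atTop (𝓝 r) := by
  have h := (((tendsto_inv_atTop_zero.comp hR).pow 2).const_add (r ^ 2)).sqrt
  simpa [smoothAbs, sqrt_sq hr] using h

/-- The truncated and smoothed extremal function on `ℝ³`. -/
def approxExtremal (R : ℝ) (x : E3) : ℝ := truncProfile R (smoothNorm R⁻¹ x)

lemma contDiff_approxExtremal {R : ℝ} (hR : 0 < R) :
    ContDiff ℝ (⊤ : ℕ∞) (approxExtremal R) := by
  have hs := contDiff_smoothNorm (inv_pos.2 hR)
  have hp : ContDiff ℝ (⊤ : ℕ∞) fun x => profile (smoothNorm R⁻¹ x) :=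
    (contDiff_const.sub hs.neg.exp).div hs fun x => (smoothNorm_pos (inv_pos.2 hR) x).ne'
  exact hp.mul (contDiff_cutoff.comp (hs.div_const R))

lemma hasCompactSupport_approxExtremal {R : ℝ} (hR : 0 < R) :
    HasCompactSupport (approxExtremal R) := by
  refine HasCompactSupport.intro (isCompact_closedBall 0 (2 * R)) fun x hx => ?_
  rw [mem_closedBall_zero_iff, not_le] at hx
  have h : 2 ≤ smoothNorm R⁻¹ x / R := by
    rw [le_div_iff₀ hR]
    exact hx.le.trans (le_smoothAbs _ _)
  have hz : cutoff (smoothNorm R⁻¹ x / R) = 0 :=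
    cutoff.zero_of_le_dist (by
      rw [Real.dist_0_eq_abs]
      exact h.trans (le_abs_self _))
  rw [approxExtremal, truncProfile, hz, mul_zero]

variable {R : ℕ → ℝ}

lemma tendsto_iSup_approxExtremal (hR1 : ∀ n, 1 ≤ R n) (hR : Tendsto R atTop atTop) :
    Tendsto (fun n => ⨆ x, |approxExtremal (R n) x|) atTop (𝓝 1) := by
  have hδ : ∀ n, 0 < (R n)⁻¹ := fun n => inv_pos.2 (one_pos.trans_le (hR1 n))
  have hle : ∀ n x, |approxExtremal (R n) x| ≤ 1 := by
    intro n x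
    have hs := smoothNorm_pos (hδ n) x
    rw [approxExtremal, truncProfile, abs_mul, abs_of_nonneg (profile_nonneg hs)]
    exact mul_le_one₀ (profile_le_one hs) (abs_nonneg _) (abs_cutoff_le_one _)
  have hs : Tendsto (fun n => smoothNorm (R n)⁻¹ 0) atTop (𝓝 0) := by
    simpa [smoothNorm] using tendsto_smoothAbs hR le_rfl
  have hzero : Tendsto (fun n => |approxExtremal (R n) 0|) atTop (𝓝 1) := by
    have hp := tendsto_profile_zero.comp (tendsto_nhdsWithin_iff.2
      ⟨hs, Eventually.of_forall fun n => smoothNorm_pos (hδ n) 0⟩)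
    have hχ := tendsto_comp_div contDiff_cutoff.continuous hR hs
    rw [cutoff_zero] at hχ
    simpa [approxExtremal, truncProfile] using (hp.mul hχ).abs
  exact tendsto_of_tendsto_of_tendsto_of_le_of_le hzero tendsto_const_nhds
    (fun n => le_ciSup (f := fun x => |approxExtremal (R n) x|)
      ⟨1, Set.forall_mem_range.2 (hle n)⟩ 0) (fun n => ciSup_le (hle n))

lemma tendsto_integral_gradient_approxExtremal (hR1 : ∀ n, 1 ≤ R n)
    (hR : Tendsto R atTop atTop) :
    Tendsto (fun n => ∫ x, ‖gradient (approxExtremal (R n)) x‖ ^ 2) atTop (𝓝 (2 * π)) := by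
  have hδ : ∀ n, 0 < (R n)⁻¹ := fun n => inv_pos.2 (one_pos.trans_le (hR1 n))
  obtain ⟨C, -, hC⟩ := exists_truncProfile_bound
  have key := tendsto_integral_sq_of_le (C := C) (G := fun r => exp (-r) - profile r)
    (F := fun n r => r * (truncProfileDeriv (R n) (smoothAbs (R n)⁻¹ r) /
      smoothAbs (R n)⁻¹ r * r)) (fun n => ?_) (fun n r hr => ?_) (fun r hr => ?_)
  · rw [integral_exp_neg_sub_profile_sq] at key
    have hlim : 2 * π = 4 * π * (1 / 2) := by ring
    rw [hlim]
    refine (key.const_mul (4 * π)).congr fun n => ?_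
    have heq : ∀ x : E3, ‖gradient (approxExtremal (R n)) x‖ ^ 2 =
        (truncProfileDeriv (R n) (smoothAbs (R n)⁻¹ ‖x‖) / smoothAbs (R n)⁻¹ ‖x‖ * ‖x‖) ^ 2 :=
      norm_gradient_comp_smoothNorm (hδ n) fun s hs => hasDerivAt_truncProfile (R n) hs.ne'
    simp_rw [heq]
    rw [integral_comp_norm fun r => (truncProfileDeriv (R n) (smoothAbs (R n)⁻¹ r) /
      smoothAbs (R n)⁻¹ r * r) ^ 2]
    simp_rw [mul_pow]
  · have h₁ := (measurable_truncProfileDeriv (R n)).comp (measurable_smoothAbs (R n)⁻¹)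
    have h₂ := measurable_smoothAbs (R n)⁻¹
    exact measurable_id.mul ((h₁.div h₂).mul measurable_id)
  · have hs := smoothAbs_pos (hδ n) r
    have hrs := le_smoothAbs (R n)⁻¹ r
    set s := smoothAbs (R n)⁻¹ r
    refine le_trans ?_ (hC (R n) s (hR1 n) hs).2.1
    have e : r * (truncProfileDeriv (R n) s / s * r) =
        (r / s) ^ 2 * (s * truncProfileDeriv (R n) s) := by
      field_simp
    rw [e, abs_mul, abs_of_nonneg (sq_nonneg (r / s))]
    have hq : (r / s) ^ 2 ≤ 1 := pow_le_one₀ (by positivity) ((div_le_one hs).2 hrs)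
    gcongr
    exact mul_le_of_le_one_left (abs_nonneg _) hq
  · have hs := tendsto_smoothAbs hR hr.le
    have h := (((tendsto_truncProfileDeriv hr.ne' hR hs).div hs hr.ne').mul_const r).const_mul r
    rwa [div_mul_cancel₀ _ hr.ne', self_mul_profileDeriv hr.ne'] at h

lemma tendsto_integral_lap_approxExtremal (hR1 : ∀ n, 1 ≤ R n) (hR : Tendsto R atTop atTop) :
    Tendsto (fun n => ∫ x, lap (approxExtremal (R n)) x ^ 2) atTop (𝓝 (2 * π)) := by
  have hδ : ∀ n, 0 < (R n)⁻¹ := fun n => inv_pos.2 (one_pos.trans_le (hR1 n))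
  obtain ⟨C, -, hC⟩ := exists_truncProfile_bound
  have key := tendsto_integral_sq_of_le (C := 4 * C) (G := fun r => -exp (-r))
    (F := fun n r => r * (r ^ 2 / smoothAbs (R n)⁻¹ r ^ 2 *
        truncProfileDeriv₂ (R n) (smoothAbs (R n)⁻¹ r) +
      truncProfileDeriv (R n) (smoothAbs (R n)⁻¹ r) *
        (3 / smoothAbs (R n)⁻¹ r - r ^ 2 / smoothAbs (R n)⁻¹ r ^ 3)))
    (fun n => ?_) (fun n r hr => ?_) (fun r hr => ?_)
  · rw [integral_exp_neg_sq] at key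
    have hlim : 2 * π = 4 * π * (1 / 2) := by ring
    rw [hlim]
    refine (key.const_mul (4 * π)).congr fun n => ?_
    have heq := lap_comp_smoothNorm (hδ n)
      (fun s hs => hasDerivAt_truncProfile (R n) hs.ne')
      (fun s hs => hasDerivAt_truncProfileDeriv (R n) hs.ne')
    unfold approxExtremal
    simp_rw [heq, smoothNorm]
    rw [integral_comp_norm fun r => (r ^ 2 / smoothAbs (R n)⁻¹ r ^ 2 *
        truncProfileDeriv₂ (R n) (smoothAbs (R n)⁻¹ r) +
      truncProfileDeriv (R n) (smoothAbs (R n)⁻¹ r) *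
        (3 / smoothAbs (R n)⁻¹ r - r ^ 2 / smoothAbs (R n)⁻¹ r ^ 3)) ^ 2]
    simp_rw [mul_pow]
  · have h₁ := (measurable_truncProfileDeriv (R n)).comp (measurable_smoothAbs (R n)⁻¹)
    have h₂ := (measurable_truncProfileDeriv₂ (R n)).comp (measurable_smoothAbs (R n)⁻¹)
    have h₃ := measurable_smoothAbs (R n)⁻¹
    simp only [Function.comp_def] at h₁ h₂
    fun_prop
  · have hs := smoothAbs_pos (hδ n) r
    have hrs := le_smoothAbs (R n)⁻¹ r
    set s := smoothAbs (R n)⁻¹ r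
    obtain ⟨hC₁, -, hC₂⟩ := hC (R n) s (hR1 n) hs
    have e : r * (r ^ 2 / s ^ 2 * truncProfileDeriv₂ (R n) s +
        truncProfileDeriv (R n) s * (3 / s - r ^ 2 / s ^ 3)) =
        (r / s) ^ 3 * (s * truncProfileDeriv₂ (R n) s) +
          (r / s) * (3 - (r / s) ^ 2) * truncProfileDeriv (R n) s := by
      field_simp
    have hq0 : 0 ≤ r / s := by positivity
    have hq1 : r / s ≤ 1 := (div_le_one hs).2 hrs
    have hq3 : (r / s) ^ 3 ≤ 1 := pow_le_one₀ hq0 hq1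
    have hq2 : (r / s) ^ 2 ≤ 1 := pow_le_one₀ hq0 hq1
    have hp0 : 0 ≤ r / s * (3 - (r / s) ^ 2) := mul_nonneg hq0 (by linarith)
    have hp3 : r / s * (3 - (r / s) ^ 2) ≤ 3 := by nlinarith [sq_nonneg (r / s)]
    have h : |r * (r ^ 2 / s ^ 2 * truncProfileDeriv₂ (R n) s +
        truncProfileDeriv (R n) s * (3 / s - r ^ 2 / s ^ 3))| ≤
        |s * truncProfileDeriv₂ (R n) s| + 3 * |truncProfileDeriv (R n) s| := by
      rw [e]
      refine (abs_add_le _ _).trans ?_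
      rw [abs_mul, abs_mul (r / s * (3 - (r / s) ^ 2)), abs_of_nonneg hp0,
        abs_of_nonneg (pow_nonneg hq0 3)]
      exact add_le_add (mul_le_of_le_one_left (abs_nonneg _) hq3)
        (mul_le_mul_of_nonneg_right hp3 (abs_nonneg _))
    refine (mul_le_mul h (add_le_add_right hrs 1) (by positivity) (by positivity)).trans ?_
    linarith
  · have hs := tendsto_smoothAbs hR hr.le
    have h₁ := tendsto_truncProfileDeriv hr.ne' hR hs
    have h₂ := tendsto_truncProfileDeriv₂ hr.ne' hR hs
    have h := ((((tendsto_const_nhds (x := r ^ 2)).div (hs.pow 2) (by positivity)).mul h₂).add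
      (h₁.mul (((tendsto_const_nhds (x := (3 : ℝ))).div hs hr.ne').sub
        ((tendsto_const_nhds (x := r ^ 2)).div (hs.pow 3) (by positivity))))).const_mul r
    have e : r * (r ^ 2 / r ^ 2 * profileDeriv₂ r +
        profileDeriv r * (3 / r - r ^ 2 / r ^ 3)) = -exp (-r) := by
      have h := self_mul_profileDeriv₂ hr.ne'
      have hr0 := hr.ne'
      field_simp
      linarith
    rwa [e] at h

lemma tendsto_agmonQuotient_approxExtremal (hR1 : ∀ n, 1 ≤ R n) (hR : Tendsto R atTop atTop) :
    Tendsto (fun n => agmonQuotient (approxExtremal (R n))) atTop (𝓝 (√(2 * π))⁻¹) := by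
  have hpos : (0 : ℝ) < 2 * π := by positivity
  have hlim : (√(2 * π))⁻¹ = 1 / ((2 * π) ^ ((1 : ℝ) / 4) * (2 * π) ^ ((1 : ℝ) / 4)) := by
    rw [← rpow_add hpos, sqrt_eq_rpow, one_div ((2 * π) ^ _)]
    norm_num
  rw [hlim]
  have hA := (tendsto_integral_gradient_approxExtremal hR1 hR).rpow_const
    (p := (1 : ℝ) / 4) (Or.inl hpos.ne')
  have hB := (tendsto_integral_lap_approxExtremal hR1 hR).rpow_const
    (p := (1 : ℝ) / 4) (Or.inl hpos.ne')
  exact (tendsto_iSup_approxExtremal hR1 hR).div (hA.mul hB) (by positivity)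

end Limits

theorem constant_is_optimal (Ω : Set E3) (hΩ : IsOpen Ω) (hne : Ω.Nonempty) :
    ∃ u : ℕ → E3 → ℝ, (∀ n, IsTestOn Ω (u n)) ∧
      Tendsto (fun n => (⨆ x, |u n x|) /
          ((∫ x, ‖gradient (u n) x‖ ^ 2) ^ ((1 : ℝ)/4) *
            (∫ x, (lap (u n) x) ^ 2) ^ ((1 : ℝ)/4)))
        atTop (nhds ((Real.sqrt (2 * Real.pi))⁻¹)) := by
  have hpos : ∀ n : ℕ, (0 : ℝ) < n + 1 := fun n => by positivity
  choose l hl x₀ hu using fun n : ℕ => exists_isTestOn_comp_dilation hΩ hne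
    (contDiff_approxExtremal (hpos n)) (hasCompactSupport_approxExtremal (hpos n))
  refine ⟨_, hu, ?_⟩
  refine (tendsto_agmonQuotient_approxExtremal (R := fun n : ℕ => (n : ℝ) + 1) (by simp)
    (tendsto_natCast_atTop_atTop.atTop_add tendsto_const_nhds)).congr fun n => ?_
  exact (agmonQuotient_comp_dilation (contDiff_approxExtremal (hpos n)) (hl n) (x₀ n)).symm
end
end
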